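/- Let D be a positive nonsquare integer such that x² − D y² = 4 is solvable in odd positive integers x and y. Let (x, y) be a positive integer solution of x² − D y² = 4 with y = p₁^{n₁} p₂^{n₂} y′, where p₁, p₂ are primes not dividing D and n₁, n₂ are positive integers. If every prime divisor of y′ divides D, then (x + y√D)/2 = ε/2, or (ε/2)², or (ε/2)³, or (ε/2)⁴, or (ε/2)⁶, or (ε/2)^q for some odd prime q with gcd(q, p₁ p₂) = 1; here ε = x₁ + y₁√D and (x₁, y₁) is the minimal positive solution of x² − D y² = 4. -/

import Mathlib

/-- Lucas sequence of the first kind with parameters `(P, 1)`. -/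
def lucU (P : ℤ) : ℕ → ℤ
  | 0 => 0
  | 1 => 1
  | (n + 2) => P * lucU P (n + 1) - lucU P n

/-- Lucas sequence of the second kind with parameters `(P, 1)`. -/
def lucV (P : ℤ) : ℕ → ℤ
  | 0 => 2
  | 1 => P
  | (n + 2) => P * lucV P (n + 1) - lucV P n

lemma lucU_zero (P : ℤ) : lucU P 0 = 0 := by simp [lucU]
lemma lucU_one (P : ℤ) : lucU P 1 = 1 := by simp [lucU]
lemma lucU_rec (P : ℤ) (n : ℕ) : lucU P (n + 2) = P * lucU P (n + 1) - lucU P n := by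
  simp [lucU]
lemma lucV_zero (P : ℤ) : lucV P 0 = 2 := by simp [lucV]
lemma lucV_one (P : ℤ) : lucV P 1 = P := by simp [lucV]
lemma lucV_rec (P : ℤ) (n : ℕ) : lucV P (n + 2) = P * lucV P (n + 1) - lucV P n := by
  simp [lucV]
lemma lucU_two (P : ℤ) : lucU P 2 = P := by simp [lucU]
lemma lucU_three (P : ℤ) : lucU P 3 = P ^ 2 - 1 := by simp [lucU]; ring
lemma lucV_two (P : ℤ) : lucV P 2 = P ^ 2 - 2 := by simp [lucV]; ring
lemma lucV_three (P : ℤ) : lucV P 3 = P ^ 3 - 3 * P := by simp [lucV]; ring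

lemma lucUV_step (P : ℤ) (n : ℕ) :
    2 * lucU P (n + 1) = P * lucU P n + lucV P n ∧
    2 * lucV P (n + 1) = P * lucV P n + (P ^ 2 - 4) * lucU P n := by
  induction n with
  | zero => simp [lucU_zero, lucU_one, lucV_zero, lucV_one]; ring
  | succ k ih =>
    obtain ⟨h1, h2⟩ := ih
    rw [lucU_rec, lucV_rec]
    constructor
    · have : 2 * (2 * (P * lucU P (k + 1) - lucU P k)) =
        2 * (P * lucU P (k + 1) + lucV P (k + 1)) := by
        linear_combination P * h1 - h2
      linarith
    · have : 2 * (2 * (P * lucV P (k + 1) - lucV P k)) =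
        2 * (P * lucV P (k + 1) + (P ^ 2 - 4) * lucU P (k + 1)) := by
        linear_combination P * h2 - (P ^ 2 - 4) * h1
      linarith

lemma lucUV_norm (P : ℤ) (n : ℕ) : lucV P n ^ 2 - (P ^ 2 - 4) * lucU P n ^ 2 = 4 := by
  induction n with
  | zero => simp [lucU_zero, lucV_zero]
  | succ k ih =>
    obtain ⟨h1, h2⟩ := lucUV_step P k
    have h : (2 * lucV P (k + 1)) ^ 2 - (P ^ 2 - 4) * (2 * lucU P (k + 1)) ^ 2 = 16 := by
      rw [h1, h2]; linear_combination 4 * ih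
    linarith

lemma lucUV_add (P : ℤ) (m n : ℕ) :
    2 * lucU P (m + n) = lucU P m * lucV P n + lucV P m * lucU P n ∧
    2 * lucV P (m + n) = lucV P m * lucV P n + (P ^ 2 - 4) * lucU P m * lucU P n := by
  induction n with
  | zero => simp [lucU_zero, lucV_zero]; constructor <;> ring
  | succ k ih =>
    obtain ⟨h1, h2⟩ := lucUV_step P k
    obtain ⟨h3, h4⟩ := lucUV_step P (m + k)
    obtain ⟨h5, h6⟩ := ih
    rw [← add_assoc]
    constructor
    · have : 2 * (2 * lucU P (m + k + 1)) =
        (lucU P m * lucV P (k + 1) + lucV P m * lucU P (k + 1)) * 2 := by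
        linear_combination 2 * h3 + P * h5 + h6 - lucU P m * h2 - lucV P m * h1
      linarith
    · have : 2 * (2 * lucV P (m + k + 1)) =
        (lucV P m * lucV P (k + 1) + (P ^ 2 - 4) * lucU P m * lucU P (k + 1)) * 2 := by
        linear_combination 2 * h4 + P * h6 + (P ^ 2 - 4) * h5 - lucV P m * h2
          - (P ^ 2 - 4) * lucU P m * h1
      linarith

lemma lucU_add_two (P : ℤ) (a m : ℕ) :
    lucU P (a + m + m) = lucV P m * lucU P (a + m) - lucU P a := by
  have h1 := (lucUV_add P (a + m) m).1
  obtain ⟨h2, h3⟩ := lucUV_add P a m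
  have h4 := lucUV_norm P m
  have : 4 * lucU P (a + m + m) = 4 * (lucV P m * lucU P (a + m) - lucU P a) := by
    linear_combination 2 * h1 + lucU P m * h3 - lucV P m * h2 - lucU P a * h4
  linarith

lemma lucU_mul (P : ℤ) (m n : ℕ) :
    lucU P (m * n) = lucU P m * lucU (lucV P m) n := by
  induction n using Nat.twoStepInduction with
  | zero => simp [lucU_zero]
  | one => simp [lucU_one]
  | more n h1 h2 =>
    have := lucU_add_two P (m * n) m
    rw [show m * (n + 2) = m * n + m + m by ring, this, lucU_rec,
      show m * n + m = m * (n + 1) by ring, h1, h2]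
    ring

lemma lucU_dvd (P : ℤ) {m n : ℕ} (h : m ∣ n) : lucU P m ∣ lucU P n := by
  obtain ⟨k, rfl⟩ := h
  rw [lucU_mul]; exact dvd_mul_right _ _

lemma lucU_consec (P : ℤ) (n : ℕ) :
    lucU P (n + 1) ^ 2 - P * lucU P (n + 1) * lucU P n + lucU P n ^ 2 = 1 := by
  induction n with
  | zero => simp [lucU_zero, lucU_one]
  | succ k ih => rw [lucU_rec]; linear_combination ih

lemma lucU_odd_factor (P : ℤ) (k : ℕ) :
    lucU P (2 * k + 1) = (lucU P (k + 1) - lucU P k) * (lucU P (k + 1) + lucU P k) := by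
  have h1 := (lucUV_add P (k + 1) k).1
  obtain ⟨h2, h3⟩ := lucUV_step P k
  rw [show k + 1 + k = 2 * k + 1 by ring] at h1
  have : 4 * lucU P (2 * k + 1) =
    4 * ((lucU P (k + 1) - lucU P k) * (lucU P (k + 1) + lucU P k)) := by
    have h4 := lucUV_norm P k
    have h5 := lucU_consec P k
    have h6 : lucV P k = 2 * lucU P (k + 1) - P * lucU P k := by linarith
    rw [h6] at h3 h4 h1
    linear_combination 2 * h1 + lucU P k * h3
  linarith

lemma lucU_ge (P : ℤ) (hP : 3 ≤ P) (k : ℕ) : (k : ℤ) ≤ lucU P k ∧ lucU P k + 1 ≤ lucU P (k + 1) := by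
  induction k with
  | zero => simp [lucU_zero, lucU_one]
  | succ k ih =>
    rw [lucU_rec]; push_cast
    obtain ⟨h1, h2⟩ := ih
    constructor
    · linarith
    · nlinarith

lemma lucV_ge (P : ℤ) (hP : 3 ≤ P) (k : ℕ) : 0 < lucV P k ∧ lucV P k < lucV P (k + 1) := by
  induction k with
  | zero => simp [lucV_zero, lucV_one]; linarith
  | succ k ih =>
    rw [lucV_rec]
    obtain ⟨h1, h2⟩ := ih
    constructor
    · linarith
    · nlinarith

lemma lucV_ge_three (P : ℤ) (hP : 3 ≤ P) (k : ℕ) (hk : 1 ≤ k) : 3 ≤ lucV P k := by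
  induction k, hk using Nat.le_induction with
  | base => simpa [lucV_one] using hP
  | succ k _ ih => linarith [(lucV_ge P hP k).2]

lemma lucA_step (P : ℤ) (k : ℕ) : lucU P (k + 2) - lucU P (k + 1) =
    (P - 2) * lucU P (k + 1) + (lucU P (k + 1) - lucU P k) := by
  rw [lucU_rec]; ring

lemma lucA_gt (P : ℤ) (hP : 3 ≤ P) (k : ℕ) (hk : 2 ≤ k) (hne : ¬ (k = 2 ∧ P = 3)) :
    ((2 * k + 1 : ℕ) : ℤ) < lucU P (k + 1) - lucU P k := by
  by_cases h3 : P = 3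
  · have hk3 : 3 ≤ k := by
      rcases Nat.lt_or_ge k 3 with h | h
      · exact absurd ⟨by omega, h3⟩ hne
      · exact h
    subst h3
    clear hne hk
    induction k, hk3 using Nat.le_induction with
    | base => simp [lucU]
    | succ k hk ih =>
      have := lucA_step 3 k
      have h1 := (lucU_ge 3 (by norm_num) (k + 1)).1
      push_cast at *
      have : (3 : ℤ) ≤ k := by exact_mod_cast hk
      linarith
  · have hP4 : 4 ≤ P := by omega
    clear hne
    induction k, hk using Nat.le_induction with
    | base => simp [lucU]; nlinarith
    | succ k hk ih =>
      have := lucA_step P k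
      have h1 := (lucU_ge P hP (k + 1)).1
      push_cast at *
      have : (2 : ℤ) ≤ k := by exact_mod_cast hk
      nlinarith

lemma lucB_gt (P : ℤ) (hP : 3 ≤ P) (k : ℕ) (hk : 2 ≤ k) :
    ((2 * k + 1 : ℕ) : ℤ) < lucU P (k + 1) + lucU P k := by
  by_cases h : k = 2 ∧ P = 3
  · obtain ⟨rfl, rfl⟩ := h
    simp [lucU]
  · have := lucA_gt P hP k hk h
    have h1 := (lucU_ge P hP k).1
    linarith

lemma lucU_even_iff (P : ℤ) (hP : Odd P) (n : ℕ) : Even (lucU P n) ↔ 3 ∣ n := by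
  have key : ∀ k, Even (lucU P (3 * k)) ∧ Odd (lucU P (3 * k + 1)) := by
    intro k
    induction k with
    | zero => simp [lucU_zero, lucU_one]
    | succ k ih =>
      obtain ⟨h1, h2⟩ := ih
      rw [show 3 * (k + 1) = 3 * k + 1 + 2 by ring, lucU_rec,
        show 3 * k + 1 + 2 + 1 = 3 * k + 2 + 2 by ring, lucU_rec P (3 * k + 2),
        show 3 * k + 2 + 1 = 3 * k + 1 + 2 by ring, lucU_rec P (3 * k + 1),
        show 3 * k + 1 + 1 = 3 * k + 2 by ring, lucU_rec P (3 * k)]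
      generalize lucU P (3 * k) = a at *
      generalize lucU P (3 * k + 1) = b at *
      rw [← Int.not_even_iff_odd] at hP h2
      simp only [← Int.not_even_iff_odd, Int.even_sub, Int.even_mul]
      tauto
  have h3 := key (n / 3)
  rcases (by omega : n = 3 * (n / 3) ∨ n = 3 * (n / 3) + 1 ∨ n = 3 * (n / 3) + 2) with h | h | h
  · rw [h]; simp [h3.1]
  · rw [h]
    have := Int.not_even_iff_odd.2 h3.2
    constructor
    · intro h; exact absurd h this
    · intro h; omega
  · rw [h, lucU_rec]
    constructor
    · intro h
      rw [← Int.not_even_iff_odd] at hP h3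
      simp only [Int.even_sub, Int.even_mul] at h
      tauto
    · intro h; omega

lemma lucV_odd (P : ℤ) (hP : Odd P) (n : ℕ) (hn : ¬ 3 ∣ n) : Odd (lucV P n) := by
  have h := lucUV_norm P n
  have h1 := (lucU_even_iff P hP n).not.2 hn
  rw [← Int.not_even_iff_odd] at hP ⊢
  intro h2
  have h3 : Even (lucV P n ^ 2 - (P ^ 2 - 4) * lucU P n ^ 2) := by rw [h]; decide
  have h4 : Even (4 : ℤ) := by decide
  simp only [Int.even_sub, Int.even_mul, Int.even_pow] at h3
  tauto

lemma lucU_exp (P : ℤ) (k : ℕ) :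
    (P ^ 2 - 4) ^ 2 ∣ 6 * lucU P (2 * k + 1) - 6 * (2 * k + 1)
      - k * (k + 1) * (2 * k + 1) * (P ^ 2 - 4) := by
  induction k using Nat.twoStepInduction with
  | zero => simp [lucU_one]
  | one => simp [lucU_three]; ring_nf; simp
  | more k h1 h2 =>
    have h3 := lucU_add_two P (2 * k + 1) 2
    rw [lucV_two] at h3
    obtain ⟨c, hc⟩ := h1
    obtain ⟨d, hd⟩ := h2
    rw [show 2 * (k + 1) + 1 = 2 * k + 1 + 2 by ring] at hd
    rw [show 2 * (k + 2) + 1 = 2 * k + 1 + 2 + 2 by ring, h3]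
    push_cast at *
    refine ⟨(P ^ 2 - 2) * d - c + (k + 1) * (k + 1 + 1) * (2 * (k + 1) + 1), ?_⟩
    linear_combination (P ^ 2 - 2) * hd - hc

lemma lucU_cong (P : ℤ) (k : ℕ) : (P ^ 2 - 4) ∣ lucU P (2 * k + 1) - (2 * k + 1) := by
  induction k using Nat.twoStepInduction with
  | zero => simp [lucU_one]
  | one => simp [lucU_three]; ring_nf; simp
  | more k h1 h2 =>
    have h3 := lucU_add_two P (2 * k + 1) 2
    rw [lucV_two] at h3
    obtain ⟨c, hc⟩ := h1
    obtain ⟨d, hd⟩ := h2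
    rw [show 2 * (k + 1) + 1 = 2 * k + 1 + 2 by ring] at hd
    rw [show 2 * (k + 2) + 1 = 2 * k + 1 + 2 + 2 by ring, h3]
    push_cast at *
    refine ⟨(P ^ 2 - 2) * d - c + (2 * (k + 1) + 1), ?_⟩
    linear_combination (P ^ 2 - 2) * hd - hc

lemma lucV_dickson (P : ℤ) (n : ℕ) : (Polynomial.dickson 1 (1 : ℤ) n).eval P = lucV P n := by
  induction n using Nat.twoStepInduction with
  | zero => simp [lucV_zero]
  | one => simp [lucV_one]
  | more n h1 h2 => simp [Polynomial.dickson_add_two, lucV_rec, h1, h2]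

lemma lucV_frob (P : ℤ) (q : ℕ) (hq : q.Prime) : (q : ℤ) ∣ lucV P q - P := by
  have := Fact.mk hq
  have h : ((lucV P q : ℤ) : ZMod q) = P := by
    rw [← lucV_dickson]
    have := Polynomial.dickson_one_one_zmod_p q
    have h2 := Polynomial.map_dickson (k := 1) (a := (1 : ℤ)) (Int.castRingHom (ZMod q)) q
    rw [map_one, this] at h2
    have h3 := congrArg (Polynomial.eval (P : ZMod q)) h2
    rw [Polynomial.eval_intCast_map] at h3
    simpa using h3
  rw [← ZMod.intCast_zmod_eq_zero_iff_dvd] <;> simp [h]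

lemma not_dvd_lucU_self (P : ℤ) (q : ℕ) (hq : q.Prime) (h : ¬ (q : ℤ) ∣ P ^ 2 - 4) :
    ¬ (q : ℤ) ∣ lucU P q := by
  intro h1
  apply h
  obtain ⟨c, hc⟩ := lucV_frob P q hq
  obtain ⟨d, hd⟩ := h1
  have h2 := lucUV_norm P q
  have h3 : lucV P q = P + q * c := by linarith
  rw [h3, hd] at h2
  exact ⟨- (2 * P * c) - q * c ^ 2 + (P ^ 2 - 4) * q * d ^ 2, by linear_combination h2⟩

lemma not_sq_dvd_lucU_self (P : ℤ) (q : ℕ) (hq : q.Prime) (h5 : 5 ≤ q) :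
    ¬ (q : ℤ) ^ 2 ∣ lucU P q := by
  intro h
  by_cases hd : (q : ℤ) ∣ P ^ 2 - 4
  · obtain ⟨k, hk⟩ := hq.odd_of_ne_two (by omega)
    have h1 := lucU_exp P k
    rw [← hk] at h1
    have hkz : (2 * k + 1 : ℤ) = q := by exact_mod_cast hk.symm
    rw [hkz] at h1
    have h2 : (q : ℤ) ^ 2 ∣ (P ^ 2 - 4) ^ 2 := pow_dvd_pow_of_dvd hd 2
    have h3 := h2.trans h1
    have h4 : (q : ℤ) ^ 2 ∣ q * 6 := by
      obtain ⟨a, ha⟩ := h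
      obtain ⟨b, hb⟩ := hd
      obtain ⟨c, hc⟩ := h3
      rw [ha, hb] at hc
      exact ⟨6 * a - k * (k + 1) * b - c, by linear_combination -hc⟩
    have hq0 : (q : ℤ) ≠ 0 := by exact_mod_cast hq.ne_zero
    rw [pow_two] at h4
    have h5' := Int.dvd_of_mul_dvd_mul_left hq0 h4
    have h6 : q ∣ 6 := by exact_mod_cast h5'
    have := Nat.le_of_dvd (by norm_num) h6
    interval_cases q <;> revert hq h6 <;> decide
  · exact not_dvd_lucU_self P q hq hd ((dvd_pow_self _ (by norm_num)).trans h)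

lemma exists_prime_of_factor (P : ℤ) (q : ℕ) (hq : q.Prime) (h5 : 5 ≤ q)
    (X : ℤ) (hX : (q : ℤ) < X) (hXU : X ∣ lucU P q) :
    ∃ r : ℕ, r.Prime ∧ (r : ℤ) ∣ X ∧ ¬ (r : ℤ) ∣ P ^ 2 - 4 ∧ r ≠ q := by
  by_contra hcon
  push Not at hcon
  lift X to ℕ using by linarith [Int.natCast_nonneg q]
  have hX' : q < X := by exact_mod_cast hX
  obtain ⟨k, hk⟩ := hq.odd_of_ne_two (by omega)
  have hall : ∀ r : ℕ, r.Prime → r ∣ X → r = q := by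
    intro r hr hrX
    by_contra hne
    have hrX' : (r : ℤ) ∣ (X : ℤ) := by exact_mod_cast hrX
    by_cases hd : (r : ℤ) ∣ P ^ 2 - 4
    · have h1 := hd.trans (lucU_cong P k)
      rw [← hk, show (2 * k + 1 : ℤ) = q by exact_mod_cast hk.symm] at h1
      have h2 := (dvd_sub_right (hrX'.trans hXU)).1 h1
      have h3 : r ∣ q := by exact_mod_cast h2
      exact hne ((Nat.prime_dvd_prime_iff_eq hr hq).1 h3)
    · exact hne (hcon r hr hrX' hd)
  have hpow := Nat.eq_prime_pow_of_unique_prime_dvd (n := X) (p := q) (by omega)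
    (fun {d} hd hdX => hall d hd hdX)
  have h2 : 2 ≤ X.primeFactorsList.length := by
    by_contra hlt
    have : X.primeFactorsList.length ≤ 1 := by omega
    have := Nat.pow_le_pow_right hq.pos this
    rw [← hpow] at this
    simp at this; omega
  have h3 : q ^ 2 ∣ X := by rw [hpow]; exact pow_dvd_pow _ h2
  exact not_sq_dvd_lucU_self P q hq h5 (dvd_trans (by exact_mod_cast h3) hXU)

lemma not_dvd_two_of_odd {a : ℤ} (ha : Odd a) : ¬ ((2 : ℕ) : ℤ) ∣ a := by
  rw [← Int.not_even_iff_odd, even_iff_two_dvd] at ha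
  exact_mod_cast ha

lemma disc_odd {P : ℤ} (hP : Odd P) : Odd (P ^ 2 - 4) := by
  have : Odd (P ^ 2) := hP.pow
  exact this.sub_even (by decide)

/-- Two primitive primes for prime index at least five. -/
lemma two_primes (P : ℤ) (hP : Odd P) (hP3 : 3 ≤ P) (q : ℕ) (hq : q.Prime) (h5 : 5 ≤ q)
    (hne : ¬ (q = 5 ∧ P = 3)) :
    ∃ r s : ℕ, r.Prime ∧ s.Prime ∧ r ≠ s ∧ (r : ℤ) ∣ lucU P q ∧ (s : ℤ) ∣ lucU P q ∧
      ¬ (r : ℤ) ∣ P ^ 2 - 4 ∧ ¬ (s : ℤ) ∣ P ^ 2 - 4 ∧ r ≠ q ∧ s ≠ q := by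
  obtain ⟨k, hk⟩ := hq.odd_of_ne_two (by omega)
  have hf := lucU_odd_factor P k
  rw [← hk] at hf
  have hA := lucA_gt P hP3 k (by omega) (by rintro ⟨rfl, h⟩; exact hne ⟨hk, h⟩)
  have hB := lucB_gt P hP3 k (by omega)
  rw [← hk] at hA hB
  obtain ⟨r, hr, hrA, hrD, hrq⟩ := exists_prime_of_factor P q hq h5 _ hA ⟨_, hf⟩
  obtain ⟨s, hs, hsB, hsD, hsq⟩ := exists_prime_of_factor P q hq h5 _ hB
    ⟨_, hf.trans (mul_comm _ _)⟩
  have hrU : (r : ℤ) ∣ lucU P q := by rw [hf]; exact hrA.mul_right _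
  have hsU : (s : ℤ) ∣ lucU P q := by rw [hf]; exact hsB.mul_left _
  refine ⟨r, s, hr, hs, ?_, hrU, hsU, hrD, hsD, hrq, hsq⟩
  rintro rfl
  have h3 : ¬ 3 ∣ q := by
    intro h
    have := (Nat.prime_dvd_prime_iff_eq Nat.prime_three hq).1 h
    omega
  have hr2 : r ≠ 2 := by
    rintro rfl
    have := (lucU_even_iff P hP q).not.2 h3
    exact not_dvd_two_of_odd (Int.not_even_iff_odd.1 this) hrU
  have hrp : Prime (r : ℤ) := Nat.prime_iff_prime_int.1 hr
  have hr2' : ¬ (r : ℤ) ∣ 2 := by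
    intro h
    exact hr2 ((Nat.prime_dvd_prime_iff_eq hr Nat.prime_two).1 (by exact_mod_cast h))
  have h1 : (r : ℤ) ∣ 2 * lucU P (k + 1) := by
    have := dvd_add hrA hsB
    ring_nf at this ⊢; exact this
  have h2 : (r : ℤ) ∣ 2 * lucU P k := by
    have := dvd_sub hsB hrA
    ring_nf at this ⊢; exact this
  have h1' := (hrp.dvd_or_dvd h1).resolve_left hr2'
  have h2' := (hrp.dvd_or_dvd h2).resolve_left hr2'
  have hc := lucU_consec P k
  apply hrp.not_dvd_one
  rw [← hc]
  refine dvd_add (dvd_sub ?_ ?_) ?_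
  · exact dvd_pow h1' (by norm_num)
  · exact h2'.mul_left _
  · exact dvd_pow h2' (by norm_num)

/-- One primitive prime for every prime index. -/
lemma one_prime (P : ℤ) (hP : Odd P) (hP3 : 3 ≤ P) (l : ℕ) (hl : l.Prime) :
    ∃ r : ℕ, r.Prime ∧ (r : ℤ) ∣ lucU P l ∧ ¬ (r : ℤ) ∣ P ^ 2 - 4 := by
  by_cases h2 : l = 2
  · subst h2
    rw [lucU_two]
    obtain ⟨r, hr, hrP⟩ := Nat.exists_prime_and_dvd (n := P.natAbs) (by omega)
    have hrP' : (r : ℤ) ∣ P := Int.natCast_dvd.2 hrP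
    refine ⟨r, hr, hrP', ?_⟩
    intro h
    have h4 : (r : ℤ) ∣ 4 := (dvd_sub_right (dvd_pow hrP' (by norm_num))).1 h
    have h4' : r ∣ 2 ^ 2 := by exact_mod_cast h4
    have := (Nat.prime_dvd_prime_iff_eq hr Nat.prime_two).1 (hr.dvd_of_dvd_pow h4')
    subst this
    exact not_dvd_two_of_odd hP hrP'
  by_cases h3 : l = 3
  · subst h3
    refine ⟨2, Nat.prime_two, ?_, not_dvd_two_of_odd (disc_odd hP)⟩
    have := (lucU_even_iff P hP 3).2 dvd_rfl
    exact_mod_cast even_iff_two_dvd.1 this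
  have h5 : 5 ≤ l := by
    have := hl.two_le
    rcases Nat.lt_or_ge l 5 with h | h
    · interval_cases l
      · omega
      · omega
      · revert hl; decide
    · exact h
  obtain ⟨k, hk⟩ := hl.odd_of_ne_two h2
  have hf := lucU_odd_factor P k
  rw [← hk] at hf
  have hB := lucB_gt P hP3 k (by omega)
  rw [← hk] at hB
  obtain ⟨s, hs, hsB, hsD, hsq⟩ := exists_prime_of_factor P l hl h5 _ hB
    ⟨_, hf.trans (mul_comm _ _)⟩
  exact ⟨s, hs, by rw [hf]; exact hsB.mul_left _, hsD⟩

/-- A prime of `U_l(V_m)` prime to its discriminant divides `U_n` but neither `P² - 4` nor `U_m`. -/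
lemma lift_prime (P : ℤ) (m l n : ℕ) (h : m * l ∣ n) (r : ℕ)
    (h1 : (r : ℤ) ∣ lucU (lucV P m) l) (h2 : ¬ (r : ℤ) ∣ (lucV P m) ^ 2 - 4) :
    (r : ℤ) ∣ lucU P n ∧ ¬ (r : ℤ) ∣ P ^ 2 - 4 ∧ ¬ (r : ℤ) ∣ lucU P m := by
  have hn : lucV P m ^ 2 - 4 = (P ^ 2 - 4) * lucU P m ^ 2 := by
    linear_combination lucUV_norm P m
  rw [hn] at h2
  refine ⟨?_, fun h => h2 (h.mul_right _), fun h => h2 ((dvd_pow h (by norm_num)).mul_left _)⟩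
  refine dvd_trans ?_ (lucU_dvd P h)
  rw [lucU_mul]
  exact h1.mul_left _

lemma small_cases (n : ℕ) (hn : 1 ≤ n) (h : ∀ q : ℕ, q.Prime → q ∣ n → q < 5) :
    n = 1 ∨ n = 2 ∨ n = 3 ∨ n = 4 ∨ n = 6 ∨ 8 ∣ n ∨ 9 ∣ n ∨ 12 ∣ n := by
  have key : ∀ a : ℕ, a ∣ n → a = 1 ∨ ∃ b, a = 2 * b ∨ a = 3 * b := by
    intro a ha
    by_cases h1 : a = 1
    · exact Or.inl h1
    · obtain ⟨q, hq, hqa⟩ := Nat.exists_prime_and_dvd h1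
      have := h q hq (hqa.trans ha)
      have h2 := hq.two_le
      obtain ⟨b, hb⟩ := hqa
      interval_cases q
      · exact Or.inr ⟨b, Or.inl hb⟩
      · exact Or.inr ⟨b, Or.inr hb⟩
      · exact absurd hq (by decide)
  rcases key n dvd_rfl with h | ⟨a, ha⟩
  · omega
  have ha' : a ∣ n := by rcases ha with h | h <;> exact ⟨_, by rw [h, mul_comm]⟩
  rcases key a ha' with h | ⟨b, hb⟩
  · omega
  have hb' : b ∣ n := by
    refine dvd_trans ?_ ha'
    rcases hb with h | h <;> exact ⟨_, by rw [h, mul_comm]⟩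
  rcases key b hb' with h | ⟨c, hc⟩
  · omega
  omega

lemma core (P : ℤ) (hP : Odd P) (hP3 : 3 ≤ P) (n : ℕ) (hn : 1 ≤ n) (D : ℤ) (hD : D ∣ P ^ 2 - 4)
    (hD5 : P = 3 → D = 5) (p₁ p₂ : ℕ) (hp₁D : ¬ (p₁ : ℤ) ∣ D) (hp₂D : ¬ (p₂ : ℤ) ∣ D)
    (hp₁ : p₁.Prime) (hp₂ : p₂.Prime)
    (h : ∀ r : ℕ, r.Prime → (r : ℤ) ∣ lucU P n → ¬ (r : ℤ) ∣ D → r = p₁ ∨ r = p₂) :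
    n = 1 ∨ n = 2 ∨ n = 3 ∨ n = 4 ∨ n = 6 ∨
        (n.Prime ∧ Odd n ∧ Nat.Coprime n (p₁ * p₂)) := by
  have three : ∀ r s t : ℕ, r.Prime → s.Prime → t.Prime → r ≠ s → r ≠ t → s ≠ t →
      (r : ℤ) ∣ lucU P n → (s : ℤ) ∣ lucU P n → (t : ℤ) ∣ lucU P n →
      ¬ (r : ℤ) ∣ D → ¬ (s : ℤ) ∣ D → ¬ (t : ℤ) ∣ D → False := by
    intro r s t hr hs ht h1 h2 h3 h4 h5 h6 h7 h8 h9
    have := h r hr h4 h7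
    have := h s hs h5 h8
    have := h t ht h6 h9
    omega
  have nd : ∀ r : ℕ, ¬ (r : ℤ) ∣ P ^ 2 - 4 → ¬ (r : ℤ) ∣ D := fun r h1 h2 => h1 (h2.trans hD)
  by_cases hq5 : ∃ q : ℕ, q.Prime ∧ q ∣ n ∧ 5 ≤ q
  · obtain ⟨q, hq, ⟨s, rfl⟩, h5⟩ := hq5
    have hqodd : Odd q := hq.odd_of_ne_two (by omega)
    have h3q : ¬ 3 ∣ q := by
      intro h
      have := (Nat.prime_dvd_prime_iff_eq Nat.prime_three hq).1 h
      omega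
    have hVodd := lucV_odd P hP q h3q
    have hV3 := lucV_ge_three P hP3 q (by omega)
    by_cases hex : q = 5 ∧ P = 3
    · obtain ⟨rfl, rfl⟩ := hex
      have hD' := hD5 rfl
      subst hD'
      by_cases hs : s = 1
      · subst hs
        refine Or.inr (Or.inr (Or.inr (Or.inr (Or.inr ⟨by norm_num, by decide, ?_⟩))))
        rw [Nat.coprime_mul_iff_right]
        refine ⟨?_, ?_⟩
        · refine (Nat.coprime_primes (by norm_num) hp₁).2 ?_
          rintro h; apply hp₁D; rw [← h]; norm_num
        · refine (Nat.coprime_primes (by norm_num) hp₂).2 ?_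
          rintro h; apply hp₂D; rw [← h]; norm_num
      · exfalso
        obtain ⟨l, hl, hls⟩ := Nat.exists_prime_and_dvd hs
        have hdv : 5 * l ∣ 5 * s := mul_dvd_mul_left 5 hls
        have hU5 : lucU 3 5 = 55 := by simp [lucU]
        have hV5 : lucV 3 5 = 123 := by simp [lucV]
        have h11 : ((11 : ℕ) : ℤ) ∣ lucU 3 (5 * s) := by
          refine dvd_trans ?_ (lucU_dvd 3 (Dvd.intro s rfl : 5 ∣ 5 * s))
          rw [hU5]; norm_num
        by_cases hl5 : 5 ≤ l
        · obtain ⟨r, t, hr, ht, hrt, hrU, htU, hrD, htD, -, -⟩ :=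
            two_primes (lucV 3 5) hVodd hV3 l hl hl5 (by rw [hV5]; norm_num)
          obtain ⟨a1, a2, a3⟩ := lift_prime 3 5 l (5 * s) hdv r hrU hrD
          obtain ⟨b1, b2, b3⟩ := lift_prime 3 5 l (5 * s) hdv t htU htD
          refine three 11 r t (by norm_num) hr ht ?_ ?_ hrt h11 a1 b1 (by norm_num)
            (nd _ a2) (nd _ b2)
          · rintro rfl; apply a3; rw [hU5]; norm_num
          · rintro rfl; apply b3; rw [hU5]; norm_num
        · have hl2 := hl.two_le
          have hUl : lucU 3 (5 * l) ∣ lucU 3 (5 * s) := lucU_dvd 3 hdv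
          rw [lucU_mul, hU5, hV5] at hUl
          have hl' : l = 2 ∨ l = 3 := by
            have : l ≠ 4 := by rintro rfl; revert hl; decide
            omega
          rcases hl' with rfl | rfl
          · rw [lucU_two] at hUl
            exact three 11 3 41 (by norm_num) (by norm_num) (by norm_num) (by norm_num)
              (by norm_num) (by norm_num) h11 (dvd_trans (by norm_num) hUl)
              (dvd_trans (by norm_num) hUl) (by norm_num) (by norm_num) (by norm_num)
          · rw [lucU_three] at hUl
            exact three 11 2 31 (by norm_num) (by norm_num) (by norm_num) (by norm_num)
              (by norm_num) (by norm_num) h11 (dvd_trans (by norm_num) hUl)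
              (dvd_trans (by norm_num) hUl) (by norm_num) (by norm_num) (by norm_num)
    · obtain ⟨r, t, hr, ht, hrt, hrU, htU, hrD, htD, hrq, htq⟩ :=
        two_primes P hP hP3 q hq h5 hex
      have hrU' := hrU.trans (lucU_dvd P (Dvd.intro s rfl : q ∣ q * s))
      have htU' := htU.trans (lucU_dvd P (Dvd.intro s rfl : q ∣ q * s))
      by_cases hs : s = 1
      · subst hs
        rw [mul_one] at *
        refine Or.inr (Or.inr (Or.inr (Or.inr (Or.inr ⟨hq, hqodd, ?_⟩))))
        have e1 := h r hr hrU (nd r hrD)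
        have e2 := h t ht htU (nd t htD)
        rw [Nat.coprime_mul_iff_right]
        refine ⟨(Nat.coprime_primes hq hp₁).2 ?_, (Nat.coprime_primes hq hp₂).2 ?_⟩ <;> omega
      · exfalso
        obtain ⟨l, hl, hls⟩ := Nat.exists_prime_and_dvd hs
        have hdv : q * l ∣ q * s := mul_dvd_mul_left q hls
        obtain ⟨w, hw, hwU, hwD⟩ := one_prime (lucV P q) hVodd hV3 l hl
        obtain ⟨a1, a2, a3⟩ := lift_prime P q l (q * s) hdv w hwU hwD
        refine three r t w hr ht hw hrt ?_ ?_ hrU' htU' a1 (nd _ hrD) (nd _ htD) (nd _ a2)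
        · rintro rfl; exact a3 hrU
        · rintro rfl; exact a3 htU
  · push Not at hq5
    have chain : ∀ l : ℕ, l.Prime → ¬ 2 * 2 * l ∣ n := by
      intro l hl hdv
      obtain ⟨r, hr, hrU, hrD⟩ := one_prime P hP hP3 2 Nat.prime_two
      obtain ⟨t, ht, htU, htD⟩ := one_prime (lucV P 2) (lucV_odd P hP 2 (by norm_num))
        (lucV_ge_three P hP3 2 (by norm_num)) 2 Nat.prime_two
      obtain ⟨w, hw, hwU, hwD⟩ := one_prime (lucV P (2 * 2)) (lucV_odd P hP (2 * 2) (by norm_num))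
        (lucV_ge_three P hP3 (2 * 2) (by norm_num)) l hl
      have h4 : 2 * 2 ∣ n := (Dvd.intro l rfl).trans hdv
      obtain ⟨a1, a2, a3⟩ := lift_prime P 2 2 (2 * 2) dvd_rfl t htU htD
      obtain ⟨b1, b2, b3⟩ := lift_prime P (2 * 2) l n hdv w hwU hwD
      have hr4 := hrU.trans (lucU_dvd P (Dvd.intro 2 rfl : 2 ∣ 2 * 2))
      refine three r t w hr ht hw ?_ ?_ ?_ (hr4.trans (lucU_dvd P h4))
        (a1.trans (lucU_dvd P h4)) b1 (nd _ hrD) (nd _ a2) (nd _ b2)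
      · rintro rfl; exact a3 hrU
      · rintro rfl; exact b3 hr4
      · rintro rfl; exact b3 a1
    rcases small_cases n hn (fun q hq hqn => hq5 q hq hqn) with h' | h' | h' | h' | h' | h' | h' | h'
    · tauto
    · tauto
    · tauto
    · tauto
    · tauto
    · exact absurd h' (chain 2 Nat.prime_two)
    · exfalso
      have hU9 : lucU P (3 * 3) ∣ lucU P n := lucU_dvd P h'
      have hU3 : lucU P 3 ∣ lucU P (3 * 3) := lucU_dvd P (Dvd.intro 3 rfl)
      have h2 : ((2 : ℕ) : ℤ) ∣ lucU P 3 := by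
        have := (lucU_even_iff P hP 3).2 dvd_rfl
        exact_mod_cast even_iff_two_dvd.1 this
      have hVeven : Even (lucV P 3) := by
        rw [lucV_three]
        exact (hP.pow).sub_odd (Odd.mul (by decide) hP)
      have hVbig : 17 ≤ lucV P 3 := by rw [lucV_three]; nlinarith [sq_nonneg (P - 3)]
      have nine : ∀ W : ℤ, 9 ∣ W - 1 ∨ 9 ∣ W + 1 → W = lucV P 3 → False := by
        intro W hW hWe
        rw [lucV_three] at hWe
        have hP9 : P % 9 = 0 ∨ P % 9 = 1 ∨ P % 9 = 2 ∨ P % 9 = 3 ∨ P % 9 = 4 ∨ P % 9 = 5 ∨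
          P % 9 = 6 ∨ P % 9 = 7 ∨ P % 9 = 8 := by omega
        have e : W % 9 = ((P % 9) ^ 3 - 3 * (P % 9)) % 9 := by
          rw [hWe]; simp [Int.sub_emod, Int.mul_emod, pow_succ]
        rcases hP9 with h | h | h | h | h | h | h | h | h <;> rw [h] at e <;> norm_num at e <;>
          omega
      have find : ∀ X : ℤ, 16 ≤ X → ¬ (9 : ℤ) ∣ X → ∃ r : ℕ, r.Prime ∧ (r : ℤ) ∣ X ∧ r ≠ 3 := by
        intro X hX hX9
        by_contra hcon
        push Not at hcon
        lift X to ℕ using by linarith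
        have hpow := Nat.eq_prime_pow_of_unique_prime_dvd (n := X) (p := 3) (by omega)
          (fun {d} hd hdX => hcon d hd (by exact_mod_cast hdX))
        have h2 : 2 ≤ X.primeFactorsList.length := by
          by_contra hlt
          have h1 : X.primeFactorsList.length ≤ 1 := by omega
          have := Nat.pow_le_pow_right (show 0 < 3 by norm_num) h1
          rw [← hpow] at this
          omega
        have h3 : 3 ^ 2 ∣ X := by rw [hpow]; exact pow_dvd_pow _ h2
        exact hX9 (by exact_mod_cast h3)
      obtain ⟨r, hr, hrX, hr3⟩ := find (lucV P 3 - 1) (by linarith)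
        (fun h => nine _ (Or.inl h) rfl)
      obtain ⟨t, ht, htX, ht3⟩ := find (lucV P 3 + 1) (by linarith)
        (fun h => nine _ (Or.inr h) rfl)
      have hr2 : r ≠ 2 := by
        rintro rfl; exact not_dvd_two_of_odd (hVeven.sub_odd odd_one) hrX
      have ht2 : t ≠ 2 := by
        rintro rfl; exact not_dvd_two_of_odd (hVeven.add_odd odd_one) htX
      have hrt : r ≠ t := by
        rintro rfl
        have := dvd_sub htX hrX
        ring_nf at this
        have h2 : r ∣ 2 := by exact_mod_cast this
        exact hr2 ((Nat.prime_dvd_prime_iff_eq hr Nat.prime_two).1 h2)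
      have hprod : lucU (lucV P 3) 3 = (lucV P 3 - 1) * (lucV P 3 + 1) := by
        rw [lucU_three]; ring
      have fin : ∀ w : ℕ, w.Prime → w ≠ 3 → (w : ℤ) ∣ lucU (lucV P 3) 3 →
          (w : ℤ) ∣ lucU P n ∧ ¬ (w : ℤ) ∣ D := by
        intro w hw hw3 hwU
        have hnd : ¬ (w : ℤ) ∣ lucV P 3 ^ 2 - 4 := by
          intro hd
          rw [lucU_three] at hwU
          have := dvd_sub hwU hd
          ring_nf at this
          have h2 : w ∣ 3 := by exact_mod_cast this
          exact hw3 ((Nat.prime_dvd_prime_iff_eq hw Nat.prime_three).1 h2)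
        obtain ⟨a1, a2, -⟩ := lift_prime P 3 3 n h' w hwU hnd
        exact ⟨a1, nd _ a2⟩
      obtain ⟨a1, a2⟩ := fin r hr hr3 (by rw [hprod]; exact hrX.mul_right _)
      obtain ⟨b1, b2⟩ := fin t ht ht3 (by rw [hprod]; exact htX.mul_left _)
      exact three 2 r t Nat.prime_two hr ht hr2.symm ht2.symm hrt (h2.trans (hU3.trans hU9))
        a1 b1 (nd _ (not_dvd_two_of_odd (disc_odd hP))) a2 b2
    · exact absurd h' (chain 3 Nat.prime_three)

/-- Every solution comes from the minimal one. -/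
lemma descent (D : ℤ) (hD : 0 < D) (hDodd : Odd D) (x₁ y₁ : ℤ) (hx₁ : 3 ≤ x₁) (hy₁ : 0 < y₁)
    (hsol₁ : x₁ ^ 2 - D * y₁ ^ 2 = 4)
    (hmin : ∀ u v : ℤ, 0 < u → 0 < v → u ^ 2 - D * v ^ 2 = 4 → y₁ ≤ v) (N : ℕ) :
    ∀ x y : ℤ, 0 < x → 0 < y → x ^ 2 - D * y ^ 2 = 4 → y.natAbs ≤ N →
      ∃ n : ℕ, 1 ≤ n ∧ x = lucV x₁ n ∧ y = y₁ * lucU x₁ n := by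
  have par : ∀ x y : ℤ, x ^ 2 - D * y ^ 2 = 4 → (Even x ↔ Even y) := by
    intro x y h
    have h3 : Even (x ^ 2 - D * y ^ 2) := by rw [h]; decide
    rw [← Int.not_even_iff_odd] at hDodd
    simp only [Int.even_sub, Int.even_mul, Int.even_pow] at h3
    tauto
  induction N with
  | zero => intro x y _ hy _ h; omega
  | succ N ih =>
    intro x y hx hy hsol hN
    have hle := hmin x y hx hy hsol
    rcases eq_or_lt_of_le hle with heq | hlt
    · subst heq
      refine ⟨1, le_rfl, ?_, by simp [lucU_one]⟩
      rw [lucV_one]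
      have : x ^ 2 = x₁ ^ 2 := by linarith
      exact (pow_left_inj₀ hx.le (by linarith) (by norm_num)).1 this
    · have p1 := par x y hsol
      have p2 := par x₁ y₁ hsol₁
      have hDne := Int.not_even_iff_odd.2 hDodd
      have e1 : Even (x * x₁ - D * (y * y₁)) := by
        simp only [Int.even_sub, Int.even_mul]; tauto
      have e2 : Even (y * x₁ - x * y₁) := by
        simp only [Int.even_sub, Int.even_mul]; tauto
      obtain ⟨a, ha⟩ := e1
      obtain ⟨b, hb⟩ := e2
      have hapos : 0 < a := by
        have : D * (y * y₁) < x * x₁ := by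
          refine lt_of_pow_lt_pow_left₀ 2 (by positivity) ?_
          have : (x * x₁) ^ 2 - (D * (y * y₁)) ^ 2 = 4 * x₁ ^ 2 + 4 * (D * y ^ 2) := by
            linear_combination x₁ ^ 2 * hsol + D * y ^ 2 * hsol₁
          have : 0 < 4 * x₁ ^ 2 + 4 * (D * y ^ 2) := by positivity
          linarith
        linarith
      have hbpos : 0 < b := by
        have : x * y₁ < y * x₁ := by
          refine lt_of_pow_lt_pow_left₀ 2 (by positivity) ?_
          have : (y * x₁) ^ 2 - (x * y₁) ^ 2 = 4 * (y ^ 2 - y₁ ^ 2) := by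
            linear_combination y ^ 2 * hsol₁ - y₁ ^ 2 * hsol
          have : y₁ ^ 2 < y ^ 2 := by gcongr
          linarith
        linarith
      have ha2 : 2 * a = x * x₁ - D * (y * y₁) := by linarith
      have hb2 : 2 * b = y * x₁ - x * y₁ := by linarith
      have hab : a ^ 2 - D * b ^ 2 = 4 := by
        have : (2 * a) ^ 2 - D * (2 * b) ^ 2 = 16 := by
          rw [ha2, hb2]
          linear_combination (x₁ ^ 2 - D * y₁ ^ 2) * hsol + 4 * hsol₁
        linarith
      have hxr : 2 * x = x₁ * a + D * y₁ * b := by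
        have : 2 * (2 * x) = 2 * (x₁ * a + D * y₁ * b) := by
          linear_combination -x₁ * ha2 - D * y₁ * hb2 - x * hsol₁
        linarith
      have hyr : 2 * y = x₁ * b + y₁ * a := by
        have : 2 * (2 * y) = 2 * (x₁ * b + y₁ * a) := by
          linear_combination -x₁ * hb2 - y₁ * ha2 - y * hsol₁
        linarith
      have hby : b < y := by nlinarith [mul_pos hy₁ hapos]
      obtain ⟨n, hn, hna, hnb⟩ := ih a b hapos hbpos hab (by omega)
      obtain ⟨s1, s2⟩ := lucUV_step x₁ n
      refine ⟨n + 1, by omega, ?_, ?_⟩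
      · have : 2 * x = 2 * lucV x₁ (n + 1) := by
          rw [s2, hxr, hnb, hna]; linear_combination -lucU x₁ n * hsol₁
        linarith
      · have : 2 * y = 2 * (y₁ * lucU x₁ (n + 1)) := by
          rw [hyr, hnb, hna]; linear_combination -y₁ * s1
        linarith

lemma real_pow (D x₁ y₁ : ℤ) (hD : 0 < D) (hsol₁ : x₁ ^ 2 - D * y₁ ^ 2 = 4) (n : ℕ) :
    (((x₁ : ℝ) + (y₁ : ℝ) * Real.sqrt (D : ℝ)) / 2) ^ n =
      ((lucV x₁ n : ℝ) + ((y₁ * lucU x₁ n : ℤ) : ℝ) * Real.sqrt (D : ℝ)) / 2 := by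
  induction n with
  | zero => simp [lucV_zero, lucU_zero]
  | succ n ih =>
    obtain ⟨s1, s2⟩ := lucUV_step x₁ n
    have s1' : 2 * (lucU x₁ (n + 1) : ℝ) = x₁ * lucU x₁ n + lucV x₁ n := by exact_mod_cast s1
    have s2' : 2 * (lucV x₁ (n + 1) : ℝ) = x₁ * lucV x₁ n + (x₁ ^ 2 - 4) * lucU x₁ n := by
      exact_mod_cast s2
    have hs : Real.sqrt (D : ℝ) ^ 2 = D := Real.sq_sqrt (by exact_mod_cast hD.le)
    have h1 : (x₁ : ℝ) ^ 2 - D * y₁ ^ 2 = 4 := by exact_mod_cast hsol₁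
    rw [pow_succ, ih]
    push_cast
    linear_combination (-1 / 4 : ℝ) * s2' - (y₁ : ℝ) * Real.sqrt D / 4 * s1'
      + (y₁ : ℝ) ^ 2 * lucU x₁ n / 4 * hs - (lucU x₁ n : ℝ) / 4 * h1

/-- Extension of Störmer's theorem for `x² - D y² = 4` (solvable in odd
positive integers) with two extra primes: a positive solution with
`y = p₁^{n₁} p₂^{n₂} y'`, `p₁, p₂` primes not dividing `D`, and every prime
divisor of `y'` dividing `D`, satisfies `(x + y√D)/2 = (ε/2)^m` with
`m ∈ {1, 2, 3, 4, 6}` or `m = q` an odd prime with `gcd(q, p₁ p₂) = 1`. -/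
theorem stormer_four_two_primes (D : ℤ) (hD : 0 < D) (hns : ¬ IsSquare D)
    (hodd : ∃ u v : ℤ, 0 < u ∧ 0 < v ∧ Odd u ∧ Odd v ∧ u ^ 2 - D * v ^ 2 = 4)
    (x₁ y₁ : ℤ) (hx₁ : 0 < x₁) (hy₁ : 0 < y₁)
    (hsol₁ : x₁ ^ 2 - D * y₁ ^ 2 = 4)
    (hmin : ∀ u v : ℤ, 0 < u → 0 < v → u ^ 2 - D * v ^ 2 = 4 →
      (x₁ : ℝ) + (y₁ : ℝ) * Real.sqrt (D : ℝ) ≤ (u : ℝ) + (v : ℝ) * Real.sqrt (D : ℝ))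
    (x y : ℤ) (hx : 0 < x) (hy : 0 < y)
    (hsol : x ^ 2 - D * y ^ 2 = 4)
    (p₁ p₂ : ℕ) (hp₁ : p₁.Prime) (hp₂ : p₂.Prime)
    (hp₁D : ¬ (p₁ : ℤ) ∣ D) (hp₂D : ¬ (p₂ : ℤ) ∣ D)
    (n₁ n₂ : ℕ) (hn₁ : 0 < n₁) (hn₂ : 0 < n₂)
    (y' : ℤ) (hyy : y = (p₁ : ℤ) ^ n₁ * (p₂ : ℤ) ^ n₂ * y')
    (hdiv : ∀ q : ℕ, q.Prime → (q : ℤ) ∣ y' → (q : ℤ) ∣ D) :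
    ∃ m : ℕ, (m = 1 ∨ m = 2 ∨ m = 3 ∨ m = 4 ∨ m = 6 ∨
        (m.Prime ∧ Odd m ∧ Nat.Coprime m (p₁ * p₂))) ∧
      ((x : ℝ) + (y : ℝ) * Real.sqrt (D : ℝ)) / 2 =
        (((x₁ : ℝ) + (y₁ : ℝ) * Real.sqrt (D : ℝ)) / 2) ^ m := by
  obtain ⟨u, v, hu, hv, huo, hvo, huv⟩ := hodd
  have hDodd : Odd D := by
    by_contra hDe
    have hDe := Int.not_odd_iff_even.1 hDe
    have h1 : Odd (u ^ 2 - D * v ^ 2) := (huo.pow).sub_even (hDe.mul_right _)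
    rw [huv] at h1
    exact absurd h1 (by decide)
  have hDR : (0 : ℝ) < D := by exact_mod_cast hD
  have hsq : 0 < Real.sqrt (D : ℝ) := Real.sqrt_pos.2 hDR
  have hymin : ∀ u v : ℤ, 0 < u → 0 < v → u ^ 2 - D * v ^ 2 = 4 → y₁ ≤ v := by
    intro u v hu hv huv
    by_contra hlt
    push Not at hlt
    have h1 := hmin u v hu hv huv
    have h2 : u < x₁ := by
      refine lt_of_pow_lt_pow_left₀ 2 hx₁.le ?_
      have : v ^ 2 < y₁ ^ 2 := by gcongr
      nlinarith
    have h3 : (u : ℝ) < x₁ := by exact_mod_cast h2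
    have h4 : (v : ℝ) < y₁ := by exact_mod_cast hlt
    have h5 := mul_lt_mul_of_pos_right h4 hsq
    linarith
  have hx₁3 : 3 ≤ x₁ := by
    have : 0 < D * y₁ ^ 2 := by positivity
    nlinarith
  have hdesc := descent D hD hDodd x₁ y₁ hx₁3 hy₁ hsol₁ hymin
  obtain ⟨k, -, -, hk⟩ := hdesc _ u v hu hv huv le_rfl
  have hy₁odd : Odd y₁ := by
    rw [hk] at hvo
    exact (Int.odd_mul.1 hvo).1
  have hx₁odd : Odd x₁ := by
    have h1 : Odd (D * y₁ ^ 2) := hDodd.mul hy₁odd.pow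
    have h2 : x₁ ^ 2 = D * y₁ ^ 2 + 4 := by linarith
    have h3 : Odd (x₁ ^ 2) := by rw [h2]; exact h1.add_even (by decide)
    exact (Int.odd_pow.1 h3).resolve_right (by norm_num)
  obtain ⟨n, hn, hxn, hyn⟩ := hdesc _ x y hx hy hsol le_rfl
  refine ⟨n, ?_, ?_⟩
  · refine core x₁ hx₁odd hx₁3 n hn D ⟨y₁ ^ 2, by linarith⟩ ?_ p₁ p₂ hp₁D hp₂D hp₁ hp₂ ?_
    · rintro rfl
      have h5 : D * y₁ ^ 2 = 5 := by linarith
      have h6 : y₁ < 3 := by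
        by_contra h; push Not at h; nlinarith
      interval_cases y₁
      · linarith
      · omega
    · intro r hr hrU hrD
      have hry : (r : ℤ) ∣ y := by rw [hyn]; exact hrU.mul_left _
      have hrp : Prime (r : ℤ) := Nat.prime_iff_prime_int.1 hr
      rw [hyy] at hry
      rcases hrp.dvd_or_dvd hry with h1 | h1
      · rcases hrp.dvd_or_dvd h1 with h2 | h2
        · left
          have h3 := hrp.dvd_of_dvd_pow h2
          exact (Nat.prime_dvd_prime_iff_eq hr hp₁).1 (by exact_mod_cast h3)
        · right
          have h3 := hrp.dvd_of_dvd_pow h2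
          exact (Nat.prime_dvd_prime_iff_eq hr hp₂).1 (by exact_mod_cast h3)
      · exact absurd (hdiv r hr h1) hrD
  · rw [real_pow D x₁ y₁ hD hsol₁ n, ← hxn, ← hyn]
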